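/- arXiv:2303.03138 — 2 statements merged into one kernel-verified Lean document; each statement's English description precedes it below -/
import Mathlib

section
/- Let K = ℚ(θ) be an algebraic number field where θ is a root of an irreducible polynomial f(x) = x^n + a·x^2 + b·x + c ∈ ℤ[x] of degree n ≥ 3 with b^2 = 4·a·c. If p is a prime such that p does not divide b and p divides the discriminant d_K of K, then p^2 does not divide d_K (i.e., the exact power of p dividing d_K is one). -/
open Polynomial NumberField

/-- The discriminant of a monic integer polynomial `f`, defined as the discriminant of the
power basis of `ℤ[X]/(f)` (junk value `0` if `f` is not monic). -/
noncomputable def polyDisc (f : Polynomial ℤ) : ℤ :=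
  if hf : f.Monic then Algebra.discr ℤ (AdjoinRoot.powerBasis' hf).basis else 0

/-- The index `[ℤ_K : ℤ[θ]]` of the order generated by `θ` in the ring of integers. -/
noncomputable def polyIndex {K : Type*} [Field K] [NumberField K] (θ : 𝓞 K) : ℕ :=
  ((Algebra.adjoin ℤ {θ}).toSubring.toAddSubgroup).index

theorem norm_algebraMap_sub_gen {F L : Type*} [Field F] [Field L] [Algebra F L]
    (pb : PowerBasis F L) (t : F) :
    Algebra.norm F (algebraMap F L t - pb.gen) = (minpoly F pb.gen).eval t := by
  rw [← charpoly_leftMulMatrix, Matrix.eval_charpoly, Algebra.norm_eq_matrix_det pb.basis, map_sub,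
    AlgHom.commutes]
  rfl

theorem exists_monic_dvd_sq {f : ℤ[X]} (hf : f.Monic) (hdeg : 2 ≤ f.natDegree) {β m : ℤ}
    (h0 : m ∣ f.eval β) (h1 : m ∣ f.derivative.eval β) :
    ∃ g : ℤ[X], g.Monic ∧ g.natDegree + 1 = f.natDegree ∧
      ∀ {R : Type _} [CommRing R] (x : R), aeval x f = 0 → (m : R) ∣ aeval x g ^ 2 := by
  have key : ∀ {q : ℤ[X]}, q.Monic → 1 ≤ q.natDegree →
      ∃ r : ℤ[X], r.Monic ∧ r.natDegree + 1 = q.natDegree ∧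
        q = C (q.eval β) + (X - C β) * r := by
    intro q hq hd
    refine ⟨q /ₘ (X - C β), ?_, ?_, ?_⟩
    · exact (leadingCoeff_divByMonic_X_sub_C q
        (natDegree_pos_iff_degree_pos.1 hd).ne' β).trans hq
    · rw [natDegree_divByMonic _ (monic_X_sub_C β), natDegree_X_sub_C]; omega
    · conv_lhs => rw [← modByMonic_add_div q (X - C β), modByMonic_X_sub_C_eq_C_eval]
  obtain ⟨q, hq, hqd, hqe⟩ := key hf (by omega)
  obtain ⟨h, hh, hhd, hhe⟩ := key hq (by omega)
  refine ⟨(X - C β) * h, (monic_X_sub_C β).mul hh, ?_, ?_⟩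
  · rw [(monic_X_sub_C β).natDegree_mul hh, natDegree_X_sub_C]; omega
  · intro R _ x hx
    have hd : f.derivative.eval β = q.eval β := by
      conv_lhs => rw [hqe]
      simp
    rw [hd] at h1
    obtain ⟨s, hs⟩ := h0
    obtain ⟨t, ht⟩ := h1
    rw [hqe, hhe, hs] at hx
    have e : q.eval β = m * t := ht
    rw [e] at hx
    simp at hx
    refine ⟨- aeval x h * (s + t * (x - β)), ?_⟩
    simp
    linear_combination (aeval x h) * hx

theorem exists_discr_eq {K : Type*} [Field K] [NumberField K] {n : ℕ}
    (hn : Module.finrank ℚ K = n) (θ : 𝓞 K) {g : ℤ[X]} (hg : g.Monic) (hgd : g.natDegree + 1 = n)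
    {m : ℤ} (hm : (m : 𝓞 K) ∣ aeval θ g) :
    ∃ M : ℤ, Algebra.discr ℚ (fun i : Fin n ↦ (θ : K) ^ (i : ℕ)) =
      (((m * M) ^ 2 * discr K : ℤ) : ℚ) := by
  classical
  subst hgd
  let b : Module.Basis (Fin (g.natDegree + 1)) ℤ (𝓞 K) :=
    (RingOfIntegers.basis K).reindex (Fintype.equivFinOfCardEq (by
      rw [← hn, ← RingOfIntegers.rank, ← Module.finrank_eq_card_chooseBasisIndex]))
  let v : Fin (g.natDegree + 1) → 𝓞 K := fun i ↦ θ ^ (i : ℕ)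
  obtain ⟨η, hη⟩ := hm
  let L : 𝓞 K →ₗ[ℤ] ℤ := (b.det.toMultilinearMap.toLinearMap v (Fin.last _))
  have hL : ∀ x, L x = b.det (Function.update v (Fin.last _) x) := fun x ↦ rfl
  have hL0 : ∀ i < g.natDegree, L (θ ^ i) = 0 := by
    intro i hi
    rw [hL]
    refine b.det.map_eq_zero_of_eq _ (i := ⟨i, by omega⟩) (j := Fin.last _) ?_ ?_
    · rw [Function.update_self, Function.update_of_ne]
      simp [Fin.ext_iff]; omega
    · simp [Fin.ext_iff]; omega
  have hLv : L (θ ^ g.natDegree) = b.det v := by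
    rw [hL]; congr 1; exact Function.update_eq_self (Fin.last _) v
  have hLg : L (aeval θ g) = b.det v := by
    rw [aeval_eq_sum_range, Finset.sum_range_succ, map_add, map_sum, Finset.sum_eq_zero,
      coeff_natDegree, hg.leadingCoeff, one_smul, zero_add, hLv]
    intro i hi
    rw [map_smul, hL0 i (Finset.mem_range.1 hi), smul_zero]
  have hdet : b.det v = m * L η := by
    rw [← hLg, hη, ← zsmul_eq_mul, map_smul, smul_eq_mul]
  refine ⟨L η, ?_⟩
  have hdis : Algebra.discr ℤ v = (m * L η) ^ 2 * discr K := by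
    rw [← b.toMatrix_map_vecMul v, Algebra.discr_of_matrix_vecMul, ← discr_eq_discr K b,
      ← hdet, b.det_apply]
  rw [← hdis, Algebra.discr_def, Algebra.discr_def, ← eq_intCast (Int.castRingHom ℚ), RingHom.map_det]
  congr 1
  ext i j
  simpa [Algebra.traceMatrix_apply, Algebra.traceForm_apply, v] using
    (Algebra.coe_trace_int (K := K) (θ ^ (i : ℕ) * θ ^ (j : ℕ))).symm

theorem norm_mul_gen_sub {m : ℕ} {a b c : ℤ} {L : Type*} [Field L] [Algebra ℚ L]
    (pb : PowerBasis ℚ L)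
    (hmin : minpoly ℚ pb.gen = X ^ (m + 2) + C (a : ℚ) * X ^ 2 + C (b : ℚ) * X + C (c : ℚ))
    (hfin : Module.finrank ℚ L = m + 2) {u : ℚ} (hu : u ≠ 0) (w : ℚ) :
    Algebra.norm ℚ (algebraMap ℚ L u * pb.gen - algebraMap ℚ L w) = (-1) ^ (m + 2) *
      (w ^ (m + 2) + a * w ^ 2 * u ^ m + b * w * u ^ (m + 1) + c * u ^ (m + 2)) := by
  have h : algebraMap ℚ L u * pb.gen - algebraMap ℚ L w =
      algebraMap ℚ L (-u) * (algebraMap ℚ L (w / u) - pb.gen) := by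
    have : algebraMap ℚ L w = algebraMap ℚ L u * algebraMap ℚ L (w / u) := by
      rw [← map_mul, mul_div_cancel₀ _ hu]
    rw [this, map_neg]
    ring
  rw [h, map_mul, Algebra.norm_algebraMap, norm_algebraMap_sub_gen, hmin, hfin, neg_pow]
  simp only [eval_add, eval_mul, eval_pow, eval_X, eval_C, div_pow]
  field_simp
  ring

theorem exists_dvd_eval_and_derivative {m : ℕ} (hm : m ≠ 0) {a b c : ℤ} (habc : b ^ 2 = 4 * a * c)
    {p : ℤ} (hp : Prime p) (hpb : ¬ p ∣ b) {k : ℕ}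
    (hE : p ^ k ∣ ((m + 2) * b) ^ (m + 2) + a * ((m + 2) * b) ^ 2 * (-(2 * a * m)) ^ m +
      b * ((m + 2) * b) * (-(2 * a * m)) ^ (m + 1) + c * (-(2 * a * m)) ^ (m + 2)) :
    ∃ β : ℤ, p ^ k ∣ (X ^ (m + 2) + C a * X ^ 2 + C b * X + C c : ℤ[X]).eval β ∧
      p ^ k ∣ (X ^ (m + 2) + C a * X ^ 2 + C b * X + C c : ℤ[X]).derivative.eval β := by
  rcases Nat.eq_zero_or_pos k with rfl | hk
  · simp
  have h4ac : ¬ p ∣ 4 * a * c := fun h ↦ hpb (hp.dvd_of_dvd_pow (habc ▸ h))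
  have h2 : ¬ p ∣ 2 := fun h ↦ h4ac ((h.mul_right (2 * a * c)).trans (by ring_nf; rfl))
  have ha : ¬ p ∣ a := fun h ↦ h4ac ((h.mul_right (4 * c)).trans (by ring_nf; rfl))
  have hc : ¬ p ∣ c := fun h ↦ h4ac (h.mul_left _)
  obtain ⟨u, hu⟩ : ∃ u : ℤ, u = -(2 * a * m) := ⟨_, rfl⟩
  obtain ⟨w, hw⟩ : ∃ w : ℤ, w = (m + 2) * b := ⟨_, rfl⟩
  rw [← hu, ← hw] at hE
  have hpE := (dvd_pow_self p hk.ne').trans hE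
  have hpu_of : p ∣ u → p ∣ (m : ℤ) := by
    rw [hu, dvd_neg]
    intro h
    rcases hp.dvd_or_dvd h with h | h
    · rcases hp.dvd_or_dvd h with h | h <;> contradiction
    · exact h
  have hpm : ¬ p ∣ (m : ℤ) + 2 := by
    intro h
    have hpw : p ∣ w := hw ▸ h.mul_right b
    have h1 : p ∣ c * u ^ (m + 2) := by
      have : c * u ^ (m + 2) = (w ^ (m + 2) + a * w ^ 2 * u ^ m + b * w * u ^ (m + 1)
        + c * u ^ (m + 2)) - w * (w ^ (m + 1) + a * w * u ^ m + b * u ^ (m + 1)) := by ring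
      rw [this]
      exact dvd_sub hpE (hpw.mul_right _)
    have h3 := hpu_of (hp.dvd_of_dvd_pow ((hp.dvd_or_dvd h1).resolve_left hc))
    exact h2 ((dvd_add_right h3).1 h)
  have hpw : ¬ p ∣ w := by
    rw [hw]
    exact fun h ↦ (hp.dvd_or_dvd h).elim hpm hpb
  have hpu : ¬ p ∣ u := by
    intro h
    obtain ⟨l, rfl⟩ := Nat.exists_eq_succ_of_ne_zero hm
    refine hpw (hp.dvd_of_dvd_pow (n := l.succ + 2) ?_)
    have : w ^ (l.succ + 2) = (w ^ (l.succ + 2) + a * w ^ 2 * u ^ l.succ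
        + b * w * u ^ (l.succ + 1) + c * u ^ (l.succ + 2))
        - u * (a * w ^ 2 * u ^ l + b * w * u ^ (l + 1) + c * u ^ (l + 2)) := by
      rw [Nat.succ_eq_add_one]; ring
    rw [this]
    exact dvd_sub hpE (h.mul_right _)
  have hcop : ∀ {x : ℤ}, ¬ p ∣ x → IsCoprime (p ^ k) x := fun hx ↦
    (hp.irreducible.coprime_iff_not_dvd.2 hx).pow_left
  obtain ⟨t, s, hst⟩ := hcop hpu
  have hβ : u * (s * w) ≡ w [ZMOD p ^ k] := by
    refine (Int.modEq_iff_dvd.2 ⟨t * w, ?_⟩)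
    linear_combination -w * hst
  obtain ⟨β, rfl⟩ : ∃ β, β = s * w := ⟨_, rfl⟩
  generalize s * w = β at hβ
  have h0 : p ^ k ∣ β ^ (m + 2) + a * β ^ 2 + b * β + c := by
    refine ((hcop hpu).pow_right (n := m + 2)).dvd_of_dvd_mul_left ?_
    have : u ^ (m + 2) * (β ^ (m + 2) + a * β ^ 2 + b * β + c) =
      (u * β) ^ (m + 2) + a * (u * β) ^ 2 * u ^ m + b * (u * β) * u ^ (m + 1)
        + c * u ^ (m + 2) := by ring
    rw [this]
    refine (Int.ModEq.dvd_iff ?_).2 hE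
    gcongr
  have hpβ : ¬ p ∣ β := fun h ↦ hpw
    ((Int.ModEq.dvd_iff (hβ.of_dvd (dvd_pow_self p hk.ne'))).1 (h.mul_left u))
  refine ⟨β, by simpa using h0, ?_⟩
  have h4 : ¬ p ∣ 4 * a * β := fun h ↦ (hp.dvd_or_dvd h).elim
    (fun h ↦ h4ac (h.mul_right c)) hpβ
  refine (hcop h4).dvd_of_dvd_mul_left ?_
  have : 4 * a * β * (X ^ (m + 2) + C a * X ^ 2 + C b * X + C c : ℤ[X]).derivative.eval β =
      4 * a * (m + 2) * (β ^ (m + 2) + a * β ^ 2 + b * β + c) +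
        (2 * a * β + b) * (u * β - w) := by
    simp [hu, hw]
    linear_combination (m + 2 : ℤ) * habc
  rw [this]
  exact dvd_add (h0.mul_left _) ((Int.modEq_iff_dvd.1 hβ.symm).mul_left _)

theorem discr_pow_eq_discr_powerBasis {F L : Type*} [Field F] [Field L] [Algebra F L]
    (pb : PowerBasis F L) {n : ℕ} (hn : pb.dim = n) :
    Algebra.discr F (fun i : Fin n ↦ pb.gen ^ (i : ℕ)) = Algebra.discr F pb.basis := by
  subst hn
  rw [pb.coe_basis]

theorem mul_norm_aeval_derivative {m : ℕ} (hm : m ≠ 0) {a b c : ℤ} (habc : b ^ 2 = 4 * a * c)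
    (ha : a ≠ 0) {L : Type*} [Field L] [Algebra ℚ L] (pb : PowerBasis ℚ L)
    (hmin : minpoly ℚ pb.gen = X ^ (m + 2) + C (a : ℚ) * X ^ 2 + C (b : ℚ) * X + C (c : ℚ))
    (hfin : Module.finrank ℚ L = m + 2) :
    (4 * a : ℚ) ^ (m + 2) * c * Algebra.norm ℚ (aeval pb.gen (minpoly ℚ pb.gen).derivative) =
      b ^ (m + 2) * (((m + 2) * b) ^ (m + 2) + a * ((m + 2) * b) ^ 2 * (-(2 * a * m)) ^ m +
        b * ((m + 2) * b) * (-(2 * a * m)) ^ (m + 1) + c * (-(2 * a * m)) ^ (m + 2)) := by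
  have habcQ : (b : ℚ) ^ 2 = 4 * a * c := mod_cast habc
  have h1 := norm_mul_gen_sub pb hmin hfin one_ne_zero 0
  have h2 := norm_mul_gen_sub pb hmin hfin (u := 2 * a) (by simpa using ha) (-b)
  have h3 := norm_mul_gen_sub pb hmin hfin (u := -(2 * a * m)) (by simpa using ⟨ha, hm⟩)
    ((m + 2) * b)
  have h4 : algebraMap ℚ L (4 * a) * (algebraMap ℚ L 1 * pb.gen - algebraMap ℚ L 0) *
      aeval pb.gen (minpoly ℚ pb.gen).derivative =
      (algebraMap ℚ L (2 * a) * pb.gen - algebraMap ℚ L (-b)) *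
      (algebraMap ℚ L (-(2 * a * m)) * pb.gen - algebraMap ℚ L ((m + 2) * b)) := by
    have hr : pb.gen ^ (m + 2) + a * pb.gen ^ 2 + b * pb.gen + c = 0 := by
      simpa [hmin] using minpoly.aeval ℚ pb.gen
    have habcL : (b : L) ^ 2 = 4 * a * c := by
      simpa using congrArg (Int.cast : ℤ → L) habc
    rw [hmin]
    simp [-eq_ratCast, map_ofNat (algebraMap ℚ L)]
    linear_combination (4 * a * (m + 2) : L) * hr + (m + 2 : L) * habcL
  have h5 := congrArg (Algebra.norm ℚ) h4
  rw [map_mul (Algebra.norm ℚ), map_mul (Algebra.norm ℚ), map_mul (Algebra.norm ℚ), h1, h2, h3,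
    Algebra.norm_algebraMap, hfin] at h5
  have h6 : ((-b : ℚ)) ^ (m + 2) + a * (-b) ^ 2 * (2 * a) ^ m + b * (-b) * (2 * a) ^ (m + 1)
      + c * (2 * a) ^ (m + 2) = (-1) ^ (m + 2) * b ^ (m + 2) := by
    rw [neg_pow (b : ℚ) (m + 2)]
    linear_combination (-a * (2 * a) ^ m : ℚ) * habcQ
  have h7 : ((-1 : ℚ) ^ (m + 2)) * (-1) ^ (m + 2) = 1 := by
    rw [← mul_pow]; simp
  have h8 : (0 : ℚ) ^ (m + 2) + a * 0 ^ 2 * 1 ^ m + b * 0 * 1 ^ (m + 1) + c * 1 ^ (m + 2) = c := by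
    simp
  rw [h6, h8] at h5
  generalize (((m + 2) * b : ℚ) ^ (m + 2) + a * ((m + 2) * b) ^ 2 * (-(2 * a * m)) ^ m +
    b * ((m + 2) * b) * (-(2 * a * m)) ^ (m + 1) + c * (-(2 * a * m)) ^ (m + 2)) = E at h5 ⊢
  generalize Algebra.norm ℚ (aeval pb.gen (minpoly ℚ pb.gen).derivative) = D at h5 ⊢
  generalize (-1 : ℚ) ^ (m + 2) = ε at h5 h7
  linear_combination ε * h5 + (b ^ (m + 2) * E * (ε * ε + 1) - (4 * a) ^ (m + 2) * c * D) * h7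

theorem stmt_7 (n : ℕ) (hn : 3 ≤ n) (a b c : ℤ) (habc : b ^ 2 = 4 * a * c)
    (f : Polynomial ℤ) (hf : f = X ^ n + C a * X ^ 2 + C b * X + C c)
    (hirr : Irreducible f)
    (K : Type*) [Field K] [NumberField K] (θ : 𝓞 K)
    (hroot : Polynomial.aeval (θ : K) f = 0)
    (hgen : Algebra.adjoin ℚ {(θ : K)} = ⊤)
    (p : ℕ) (hp : p.Prime) (hpb : ¬ (p : ℤ) ∣ b)
    (hpd : (p : ℤ) ∣ NumberField.discr K) :
    ¬ (p : ℤ) ^ 2 ∣ NumberField.discr K := by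
  intro hsq
  obtain ⟨m, rfl⟩ : ∃ m, n = m + 2 := ⟨n - 2, by omega⟩
  have hm : m ≠ 0 := by omega
  have hpp : Prime (p : ℤ) := Nat.prime_iff_prime_int.1 hp
  have hb : b ≠ 0 := by rintro rfl; simp at hpb
  have hac : 4 * a * c ≠ 0 := habc ▸ pow_ne_zero 2 hb
  have ha : a ≠ 0 := by rintro rfl; simp at hac
  have hc : c ≠ 0 := by rintro rfl; simp at hac
  have hfd : f.natDegree = m + 2 := by
    rw [hf]; compute_degree!; omega
  have hfm : f.Monic := by
    rw [hf]; monicity!; simp; omega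
  have hint : IsIntegral ℚ (θ : K) := Algebra.IsIntegral.isIntegral _
  have hmin_map : minpoly ℚ (θ : K) = f.map (algebraMap ℤ ℚ) := by
    refine (minpoly.eq_of_irreducible_of_monic ?_ ?_ (hfm.map _)).symm
    · exact (hfm.irreducible_iff_irreducible_map_fraction_map).1 hirr
    · rwa [aeval_map_algebraMap]
  have hmin : minpoly ℚ (θ : K) =
      X ^ (m + 2) + C (a : ℚ) * X ^ 2 + C (b : ℚ) * X + C (c : ℚ) := by
    rw [hmin_map, hf]
    simp
  let pb := PowerBasis.ofAdjoinEqTop hint hgen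
  have hgen' : pb.gen = θ := rfl
  have hpbdim : pb.dim = m + 2 := by
    rw [← pb.natDegree_minpoly, hgen', hmin_map, hfm.natDegree_map, hfd]
  have hfin : Module.finrank ℚ K = m + 2 := pb.finrank.trans hpbdim
  have hD := mul_norm_aeval_derivative hm habc ha pb (hgen' ▸ hmin) hfin
  obtain ⟨E, hE⟩ : ∃ E : ℤ, E = ((m + 2) * b) ^ (m + 2)
      + a * ((m + 2) * b) ^ 2 * (-(2 * a * m)) ^ m
      + b * ((m + 2) * b) * (-(2 * a * m)) ^ (m + 1) + c * (-(2 * a * m)) ^ (m + 2) := ⟨_, rfl⟩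
  have hEQ := congrArg (Int.cast : ℤ → ℚ) hE
  push_cast at hEQ
  rw [← hEQ] at hD
  obtain ⟨ε, hε, hdisc⟩ : ∃ ε : ℤ, ε * ε = 1 ∧ ((4 * a) ^ (m + 2) * c : ℤ) *
      Algebra.discr ℚ (fun i : Fin (m + 2) ↦ (θ : K) ^ (i : ℕ)) = (ε * b ^ (m + 2) * E : ℤ) := by
    refine ⟨(-1) ^ (Module.finrank ℚ K * (Module.finrank ℚ K - 1) / 2), ?_, ?_⟩
    · rw [← mul_pow]; simp
    · rw [← hgen', discr_pow_eq_discr_powerBasis pb hpbdim,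
        Algebra.discr_powerBasis_eq_norm]
      push_cast
      linear_combination
        (-1) ^ (Module.finrank ℚ K * (Module.finrank ℚ K - 1) / 2) * hD
  have hE0 : E ≠ 0 := by
    rintro rfl
    have h := Algebra.discr_not_zero_of_basis ℚ pb.basis
    rw [← discr_pow_eq_discr_powerBasis pb hpbdim, hgen'] at h
    simp [ha, hc, h] at hdisc
  have hdvd : ∀ j : ℕ, (p : ℤ) ^ (2 * j) ∣ E := by
    intro j
    induction j with
    | zero => simp
    | succ j ih =>
      obtain ⟨β, hβ0, hβ1⟩ := exists_dvd_eval_and_derivative hm habc hpp hpb (hE ▸ ih)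
      rw [← hf] at hβ0 hβ1
      obtain ⟨g, hg, hgd, hgdvd⟩ := exists_monic_dvd_sq hfm (by omega) hβ0 hβ1
      have hθ : aeval θ f = 0 := by
        apply RingOfIntegers.coe_injective
        rw [map_zero, ← hroot]
        exact (aeval_algebraMap_apply K θ f).symm
      have hpg : (((p : ℤ) ^ j : ℤ) : 𝓞 K) ∣ aeval θ g := by
        rw [← IsIntegrallyClosed.pow_dvd_pow_iff two_ne_zero, ← Int.cast_pow, ← pow_mul,
          mul_comm]
        exact hgdvd θ hθ
      obtain ⟨M, hM⟩ := exists_discr_eq hfin θ hg (hgd.trans hfd) hpg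
      rw [hM] at hdisc
      have hdisc' : ((4 * a) ^ (m + 2) * c) * (((p : ℤ) ^ j * M) ^ 2 * discr K) =
        ε * b ^ (m + 2) * E := mod_cast hdisc
      obtain ⟨t, ht⟩ := hsq
      have hcop : IsCoprime ((p : ℤ) ^ (2 * (j + 1))) (b ^ (m + 2)) :=
        (hpp.irreducible.coprime_iff_not_dvd.2 hpb).pow
      refine hcop.dvd_of_dvd_mul_left ⟨ε * ((4 * a) ^ (m + 2) * c) * M ^ 2 * t, ?_⟩
      rw [ht] at hdisc'
      linear_combination -ε * hdisc' - b ^ (m + 2) * E * hε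
  obtain ⟨k, hk⟩ := Int.finiteMultiplicity_iff (a := (p : ℤ)).2 ⟨by simpa using hp.ne_one, hE0⟩
  exact hk ((pow_dvd_pow (p : ℤ) (by omega)).trans (hdvd (k + 1)))
end

section
/- Let f(x) = x^n + a·x^2 + b·x + c ∈ ℤ[x] be an irreducible polynomial of degree n ≥ 3 with b^2 = 4·a·c, θ a root of f, K = ℚ(θ). Write |D_f| = ∏_{i=1}^{k} p_i^{r_i} · ∏_{j=1}^{l} q_j^{t_j} as a product of powers of distinct primes, where each p_i divides b and each q_j does not divide b. If no p_i divides the index [ℤ_K : ℤ[θ]], then the absolute value of the discriminant d_K of K equals ∏_{i=1}^{k} p_i^{r_i} · ∏_{j=1}^{l} q_j^{(1−(−1)^{t_j})/2}, i.e., |d_K| = ∏_{i=1}^{k} p_i^{r_i} times the product of those q_j for which t_j is odd. -/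
open Polynomial NumberField

open Module

section MonogenicOrder

variable {K : Type*} [Field K] [NumberField K] {f : ℤ[X]} {θ : 𝓞 K}

/-- A monic irreducible integer polynomial vanishing at `θ` divides every other one. -/
lemma dvd_of_aeval_eq_zero (hf : f.Monic) (hirr : Irreducible f)
    (hroot : aeval (θ : K) f = 0) {g : ℤ[X]} (hg : aeval (θ : K) g = 0) : f ∣ g := by
  have hint : IsIntegral ℤ (θ : K) := ⟨f, hf, hroot⟩
  have h := minpoly.isIntegrallyClosed_dvd hint hroot
  have h' := (minpoly.irreducible hint).dvd_symm hirr h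
  exact h'.trans (minpoly.isIntegrallyClosed_dvd hint hg)

lemma minpoly_rat_eq_map (hf : f.Monic) (hirr : Irreducible f)
    (hroot : aeval (θ : K) f = 0) : minpoly ℚ (θ : K) = f.map (algebraMap ℤ ℚ) := by
  refine (minpoly.eq_of_irreducible_of_monic ?_ ?_ (hf.map _)).symm
  · exact hf.irreducible_iff_irreducible_map_fraction_map.1 hirr
  · rwa [aeval_map_algebraMap]

/-- The powers of `θ` form a rational power basis with discriminant `polyDisc f`. -/
lemma exists_powerBasis_discr_eq_polyDisc (hf : f.Monic) (hirr : Irreducible f)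
    (hroot : aeval (θ : K) f = 0) (hgen : Algebra.adjoin ℚ {(θ : K)} = ⊤) :
    ∃ pb : PowerBasis ℚ K, pb.gen = θ ∧ pb.dim = f.natDegree ∧
      Algebra.discr ℚ (fun i : Fin f.natDegree ↦ (θ : K) ^ (i : ℕ)) = polyDisc f ∧
      Algebra.discr ℚ pb.basis = polyDisc f := by
  let φ : AdjoinRoot f →ₐ[ℤ] K := AdjoinRoot.liftAlgHom f (Algebra.ofId ℤ K) (θ : K) hroot
  have hφ (g : ℤ[X]) : φ (AdjoinRoot.mk f g) = aeval (θ : K) g := by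
    simp [φ]; rfl
  let _ : Algebra (AdjoinRoot f) K := φ.toRingHom.toAlgebra
  have hmap (x : AdjoinRoot f) : algebraMap (AdjoinRoot f) K x = φ x := rfl
  have : IsScalarTower ℤ (AdjoinRoot f) K := IsScalarTower.of_algebraMap_eq' φ.comp_algebraMap.symm
  have hinj : Function.Injective φ := by
    rw [injective_iff_map_eq_zero]
    intro x
    induction x using AdjoinRoot.induction_on with
    | ih g =>
      intro hx
      rw [hφ] at hx
      exact AdjoinRoot.mk_eq_zero.2 (dvd_of_aeval_eq_zero hf hirr hroot hx)
  have hloc :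
      IsLocalization (Algebra.algebraMapSubmonoid (AdjoinRoot f) (nonZeroDivisors ℤ)) K := by
    refine ⟨?_, ?_, ?_⟩
    · rintro ⟨_, z, hz, rfl⟩
      rw [hmap, φ.commutes]
      simpa using nonZeroDivisors.ne_zero hz
    · intro x
      have hx : x ∈ Algebra.adjoin ℚ {(θ : K)} := hgen ▸ Algebra.mem_top
      rw [Algebra.adjoin_singleton_eq_range_aeval] at hx
      obtain ⟨g, rfl⟩ := hx
      obtain ⟨d, hd, hg⟩ := IsLocalization.integerNormalization_spec (nonZeroDivisors ℤ) g
      refine ⟨⟨AdjoinRoot.mk f (IsLocalization.integerNormalization (nonZeroDivisors ℤ) g),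
        ⟨_, d, hd, rfl⟩⟩, ?_⟩
      rw [hmap, hmap, hφ, φ.commutes, ← aeval_map_algebraMap ℚ, hg]
      simp [mul_comm]
    · intro x y hxy
      exact ⟨1, by rw [hinj hxy]⟩
  let B := (AdjoinRoot.powerBasis' hf).basis
  let B' : Basis (Fin f.natDegree) ℚ K := B.localizationLocalization ℚ (nonZeroDivisors ℤ) K
  have hB' (i : Fin f.natDegree) : B' i = (θ : K) ^ (i : ℕ) := by
    refine (Basis.localizationLocalization_apply ℚ (nonZeroDivisors ℤ) K B i).trans ?_
    have hB : B i = AdjoinRoot.root f ^ (i : ℕ) := (AdjoinRoot.powerBasis' hf).basis_eq_pow i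
    rw [hmap, hB, map_pow]
    exact congrArg (· ^ (i : ℕ)) ((hφ X).trans (aeval_X _))
  have hdisc : Algebra.discr ℚ B' = polyDisc f := by
    rw [polyDisc, dif_pos hf]
    exact Algebra.discr_localizationLocalization ℤ (nonZeroDivisors ℤ) K B
  refine ⟨⟨θ, f.natDegree, B', hB'⟩, rfl, rfl, ?_, hdisc⟩
  rw [← hdisc]
  congr 1
  ext i
  exact (hB' i).symm

/-- The discriminant of `f` is the squared index times the field discriminant. -/
lemma polyDisc_eq_sq_index_mul_discr (hf : f.Monic) (hirr : Irreducible f)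
    (hroot : aeval (θ : K) f = 0) (hgen : Algebra.adjoin ℚ {(θ : K)} = ⊤) :
    polyDisc f = (polyIndex θ : ℤ) ^ 2 * NumberField.discr K := by
  obtain ⟨pb, -, hdim, hdisc, hdisc'⟩ := exists_powerBasis_discr_eq_polyDisc hf hirr hroot hgen
  have hcard : Fintype.card (Free.ChooseBasisIndex ℤ (𝓞 K)) = Fintype.card (Fin f.natDegree) := by
    rw [← Module.finrank_eq_card_basis (integralBasis K), pb.finrank, hdim, Fintype.card_fin]
  let ω := (RingOfIntegers.basis K).reindex (Fintype.equivOfCardEq hcard)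
  let v : Fin f.natDegree → 𝓞 K := fun i ↦ θ ^ (i : ℕ)
  have hv : Algebra.discr ℤ v = polyDisc f := by
    apply Int.cast_injective (α := ℚ)
    rw [← hdisc, Algebra.discr_def, Algebra.discr_def]
    change algebraMap ℤ ℚ _ = _
    rw [RingHom.map_det]
    congr 1
    ext i j
    simp only [RingHom.mapMatrix_apply, Matrix.map_apply, Algebra.traceMatrix_apply,
      Algebra.traceForm_apply]
    rw [← Algebra.trace_localization ℤ (Rₘ := ℚ) (Sₘ := K) (nonZeroDivisors ℤ)]
    simp [v]
  have hroot' : aeval θ f = 0 := by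
    apply RingOfIntegers.coe_injective
    rw [map_zero, ← hroot, ← aeval_algebraMap_apply]
  have hspan : Submodule.span ℤ (Set.range v) =
      Subalgebra.toSubmodule (Algebra.adjoin ℤ {θ}) := by
    apply le_antisymm
    · rw [Submodule.span_le]
      rintro _ ⟨i, rfl⟩
      exact pow_mem (Algebra.self_mem_adjoin_singleton ℤ θ) _
    · intro x hx
      rw [Subalgebra.mem_toSubmodule, Algebra.adjoin_singleton_eq_range_aeval] at hx
      obtain ⟨g, rfl⟩ := hx
      have hg : aeval θ g = aeval θ (g %ₘ f) := by
        rw [modByMonic_eq_sub_mul_div, map_sub, map_mul, hroot', zero_mul, sub_zero]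
      change aeval θ g ∈ _
      rw [hg, aeval_eq_sum_range' (natDegree_modByMonic_lt g hf hirr.ne_one)]
      refine Submodule.sum_mem _ fun i hi ↦ Submodule.smul_mem _ _ (Submodule.subset_span ?_)
      exact ⟨⟨i, Finset.mem_range.1 hi⟩, rfl⟩
  have hli : LinearIndependent ℤ v := by
    by_contra h
    have hz := Algebra.discr_zero_of_not_linearIndependent ℤ h
    rw [hv] at hz
    exact Algebra.discr_not_zero_of_basis ℚ pb.basis (by rw [hdisc', hz, Int.cast_zero])
  let bN : Basis (Fin f.natDegree) ℤ (Algebra.adjoin ℤ {θ}).toSubring.toAddSubgroup :=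
    (Basis.span hli).map (LinearEquiv.ofEq _ _ hspan)
  have hbN (i) : (bN i : 𝓞 K) = v i :=
    congrArg Subtype.val (Basis.span_apply hli i)
  have hidx : polyIndex θ = (ω.det v).natAbs := by
    rw [polyIndex, AddSubgroup.index_eq_natAbs_det ω _ bN]
    simp_rw [hbN]
  have hP := Algebra.discr_of_matrix_vecMul (A := ℤ) ω (ω.toMatrix v)
  rw [ω.toMatrix_map_vecMul, hv, NumberField.discr_eq_discr K ω] at hP
  rw [hP, hidx, Int.natCast_natAbs, sq_abs, Basis.det_apply]

lemma norm_algebraMap_sub (hf : f.Monic) (hirr : Irreducible f)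
    (hroot : aeval (θ : K) f = 0) (pb : PowerBasis ℚ K) (hpb : pb.gen = θ) (r : ℚ) :
    Algebra.norm ℚ (algebraMap ℚ K r - θ) = aeval r f := by
  rw [Algebra.norm_eq_matrix_det pb.basis, map_sub, ← hpb, AlgHom.commutes,
    ← eval_map_algebraMap, ← minpoly_rat_eq_map hf hirr hroot, ← hpb,
    ← charpoly_leftMulMatrix, Matrix.eval_charpoly]
  rfl

lemma abs_polyDisc_eq_abs_norm (hf : f.Monic) (hirr : Irreducible f)
    (hroot : aeval (θ : K) f = 0) (hgen : Algebra.adjoin ℚ {(θ : K)} = ⊤) :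
    |(polyDisc f : ℚ)| = |Algebra.norm ℚ (aeval (θ : K) (derivative f))| := by
  obtain ⟨pb, hpb, -, -, hdisc⟩ := exists_powerBasis_discr_eq_polyDisc hf hirr hroot hgen
  rw [← hdisc, Algebra.discr_powerBasis_eq_norm, hpb, minpoly_rat_eq_map hf hirr hroot,
    derivative_map, aeval_map_algebraMap, abs_mul, abs_pow]
  simp

end MonogenicOrder

section IndexDivisibility

variable {K : Type*} [Field K] [NumberField K] {f : ℤ[X]} {θ : 𝓞 K}

lemma exists_monic_eq_sq_mul_add (hf : f.Monic) (hdeg : 2 < f.natDegree) (x : ℤ) :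
    ∃ h : ℤ[X], h.Monic ∧ h.natDegree + 2 = f.natDegree ∧
      f = (X - C x) ^ 2 * h + (C ((derivative f).eval x) * (X - C x) + C (f.eval x)) := by
  obtain ⟨h, hh⟩ := binomExpansion (f.map C) (C x) (X - C x)
  have heq : f = (X - C x) ^ 2 * h + (C ((derivative f).eval x) * (X - C x) + C (f.eval x)) := by
    have e₁ : (f.map C).eval X = f := by rw [eval_map, eval₂_C_X]
    rw [add_sub_cancel, e₁, derivative_map, eval_map_apply, eval_map_apply] at hh
    linear_combination hh
  have hlt : (C ((derivative f).eval x) * (X - C x) + C (f.eval x)).degree < f.degree := by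
    rw [degree_eq_natDegree hf.ne_zero]
    refine lt_of_le_of_lt (b := ((1 : ℕ) : WithBot ℕ)) ?_ (by exact_mod_cast (by omega))
    refine natDegree_le_iff_degree_le.1 ?_
    compute_degree
  have hsub := sub_eq_of_eq_add heq
  have hsq : ((X - C x) ^ 2).Monic := (monic_X_sub_C x).pow 2
  have hmon : h.Monic := hsq.of_mul_monic_left (hsub ▸ hf.sub_of_left hlt)
  have hdeg' := natDegree_eq_of_degree_eq (degree_sub_eq_left_of_degree_lt hlt)
  rw [hsub, hsq.natDegree_mul hmon, natDegree_pow, natDegree_X_sub_C] at hdeg'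
  exact ⟨h, hmon, by omega, heq⟩

/-- If `N ^ 2` divides the value of `f` at `x` and `N` divides the value of its derivative there,
then `N` divides the index of `ℤ[θ]`. -/
lemma dvd_polyIndex (hf : f.Monic) (hirr : Irreducible f)
    (hroot : aeval (θ : K) f = 0) (hdeg : 2 < f.natDegree) {N : ℕ} (hN : N ≠ 0) (x : ℤ)
    (h₀ : (N : ℤ) ^ 2 ∣ f.eval x) (h₁ : (N : ℤ) ∣ (derivative f).eval x) :
    N ∣ polyIndex θ := by
  obtain ⟨h, hmon, hhdeg, heq⟩ := exists_monic_eq_sq_mul_add hf hdeg x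
  obtain ⟨B, hB⟩ := h₀
  obtain ⟨A, hA⟩ := h₁
  have hNK : (N : K) ≠ 0 := Nat.cast_ne_zero.2 hN
  let y : K := θ - x
  let W : 𝓞 K := aeval θ h
  let w : K := aeval (θ : K) h
  have hW : algebraMap (𝓞 K) K W = w := (aeval_algebraMap_apply K θ h).symm
  have hrel : y ^ 2 * w + (N * A * y + N ^ 2 * B) = 0 := by
    rw [← hroot, heq, hA, hB]
    simp [y, w]
  have hzint : IsIntegral ℤ (y * w / N) := by
    refine isIntegral_trans (A := 𝓞 K) _ ⟨X ^ 2 + C (A : 𝓞 K) * X + C (B * W), ?_, ?_⟩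
    · monicity!
    · simp only [eval₂_add, eval₂_mul, eval₂_pow, eval₂_X, eval₂_C]
      simp only [map_mul, map_intCast, hW]
      field_simp
      linear_combination w * hrel
  let z : 𝓞 K := ⟨y * w / N, hzint⟩
  let S := (Algebra.adjoin ℤ {θ}).toSubring.toAddSubgroup
  have hgdeg : ((X - C x) * h).natDegree < f.natDegree := by
    rw [(monic_X_sub_C x).natDegree_mul hmon, natDegree_X_sub_C]
    omega
  have hg : ((X - C x) * h).Monic := (monic_X_sub_C x).mul hmon
  have key (j : ℕ) : j • (z : 𝓞 K ⧸ S) = 0 ↔ N ∣ j := by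
    rw [← QuotientAddGroup.mk_nsmul, QuotientAddGroup.eq_zero_iff]
    constructor
    · intro hj
      have hj : j • z ∈ Algebra.adjoin ℤ {θ} := hj
      rw [Algebra.adjoin_singleton_eq_range_aeval] at hj
      obtain ⟨g, hgz⟩ := hj
      have hgz' : aeval (θ : K) g = j * (y * w / N) := by
        have := congrArg (algebraMap (𝓞 K) K) hgz
        rw [nsmul_eq_mul, map_mul, map_natCast] at this
        exact (aeval_algebraMap_apply K θ g).trans this
      have hzero : aeval (θ : K) (C (j : ℤ) * ((X - C x) * h) - C (N : ℤ) * (g %ₘ f)) = 0 := by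
        have : aeval (θ : K) (g %ₘ f) = aeval (θ : K) g := by
          rw [modByMonic_eq_sub_mul_div, map_sub, map_mul, hroot, zero_mul, sub_zero]
        simp [this, hgz']
        change (j : K) * (y * w) - _ = 0
        field_simp
        ring
      have hdvd := dvd_of_aeval_eq_zero hf hirr hroot hzero
      have hpz := eq_zero_of_dvd_of_degree_lt hdvd ?_
      · have := congrArg (fun P ↦ P.coeff ((X - C x) * h).natDegree) (sub_eq_zero.1 hpz)
        simp only [coeff_C_mul, hg.coeff_natDegree, mul_one] at this
        exact Int.natCast_dvd_natCast.1 ⟨_, this⟩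
      · refine degree_lt_degree ((natDegree_sub_le _ _).trans_lt (max_lt ?_ ?_))
        · exact (natDegree_C_mul_le _ _).trans_lt hgdeg
        · exact (natDegree_C_mul_le _ _).trans_lt (natDegree_modByMonic_lt g hf hirr.ne_one)
    · rintro ⟨j, rfl⟩
      have : (N * j) • z = aeval θ (C (j : ℤ) * ((X - C x) * h)) := by
        apply RingOfIntegers.coe_injective
        rw [nsmul_eq_mul, map_mul, map_natCast, ← aeval_algebraMap_apply]
        simp
        change (N * j : K) * (y * w / N) = j * (y * w)
        field_simp
      rw [this]
      exact aeval_mem_adjoin_singleton ℤ θ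
  have horder : addOrderOf (z : 𝓞 K ⧸ S) = N :=
    Nat.dvd_antisymm (addOrderOf_dvd_iff_nsmul_eq_zero.2 ((key N).2 dvd_rfl))
      ((key _).1 (addOrderOf_nsmul_eq_zero _))
  rw [← horder]
  exact addOrderOf_dvd_natCard _

end IndexDivisibility

section SquareTail

variable {n : ℕ} {a b c : ℤ}

lemma monic_trinomial (hn : 3 ≤ n) : (X ^ n + C a * X ^ 2 + C b * X + C c : ℤ[X]).Monic := by
  have h : (C a * X ^ 2 + C b * X + C c : ℤ[X]).degree < (n : WithBot ℕ) :=
    degree_quadratic_lt.trans_le (by exact_mod_cast hn)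
  rw [add_assoc, add_assoc, ← add_assoc (C a * X ^ 2)]
  exact monic_X_pow_add h

lemma natDegree_trinomial (hn : 3 ≤ n) :
    (X ^ n + C a * X ^ 2 + C b * X + C c : ℤ[X]).natDegree = n := by
  compute_degree! <;> omega

/-- The norm of `v - uθ` is the homogenisation of the minimal polynomial of `θ` at `(v, u)`. -/
lemma norm_sub_mul_eq {K : Type*} [Field K] [NumberField K] {θ : 𝓞 K} (hn : 3 ≤ n)
    (hirr : Irreducible (X ^ n + C a * X ^ 2 + C b * X + C c : ℤ[X]))
    (hroot : aeval (θ : K) (X ^ n + C a * X ^ 2 + C b * X + C c : ℤ[X]) = 0)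
    (hgen : Algebra.adjoin ℚ {(θ : K)} = ⊤) (v : ℤ) {u : ℤ} (hu : u ≠ 0) :
    Algebra.norm ℚ ((v : K) - u * θ) =
      v ^ n + a * v ^ 2 * u ^ (n - 2) + b * v * u ^ (n - 1) + c * u ^ n := by
  obtain ⟨pb, hpb, hdim, -, -⟩ :=
    exists_powerBasis_discr_eq_polyDisc (monic_trinomial hn) hirr hroot hgen
  have huK : (u : K) ≠ 0 := Int.cast_ne_zero.2 hu
  have huQ : (u : ℚ) ≠ 0 := Int.cast_ne_zero.2 hu
  have hsplit : (v : K) - u * θ =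
      algebraMap ℚ K u * (algebraMap ℚ K ((v : ℚ) / u) - θ) := by
    simp only [map_div₀, map_intCast]
    field_simp
  rw [hsplit, map_mul, Algebra.norm_algebraMap, pb.finrank, hdim, natDegree_trinomial hn,
    norm_algebraMap_sub (monic_trinomial hn) hirr hroot pb hpb]
  obtain ⟨m, rfl⟩ : ∃ m, n = m + 3 := ⟨n - 3, by omega⟩
  simp only [map_add, map_mul, map_pow, aeval_X, eq_intCast, map_intCast,
    show m + 3 - 2 = m + 1 by omega, show m + 3 - 1 = m + 2 by omega, div_pow]
  field_simp
  ring

/-- A cleared-denominator form of the discriminant of `x ^ n + a x ^ 2 + b x + c`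
when `b ^ 2 = 4ac`. -/
lemma abs_polyDisc_mul_eq {K : Type*} [Field K] [NumberField K] {θ : 𝓞 K} (hn : 3 ≤ n)
    (habc : b ^ 2 = 4 * a * c) (ha : a ≠ 0)
    (hirr : Irreducible (X ^ n + C a * X ^ 2 + C b * X + C c : ℤ[X]))
    (hroot : aeval (θ : K) (X ^ n + C a * X ^ 2 + C b * X + C c : ℤ[X]) = 0)
    (hgen : Algebra.adjoin ℚ {(θ : K)} = ⊤) (s : ℤ) (hs : s = 2 * a * (2 - n)) :
    |c * (4 * a) ^ n * polyDisc (X ^ n + C a * X ^ 2 + C b * X + C c)| =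
      |b ^ n * ((n * b) ^ n + a * (n * b) ^ 2 * s ^ (n - 2) + b * (n * b) * s ^ (n - 1) +
        c * s ^ n)| := by
  have hs0 : s ≠ 0 := by
    rw [hs]
    exact mul_ne_zero (by simpa using ha) (by omega)
  have h₁ := norm_sub_mul_eq hn hirr hroot hgen 0 (u := 4 * a) (by simpa using ha)
  have h₂ := norm_sub_mul_eq hn hirr hroot hgen b (u := -2 * a) (by simpa using ha)
  have h₃ := norm_sub_mul_eq hn hirr hroot hgen (n * b) hs0
  have hD := abs_polyDisc_eq_abs_norm (monic_trinomial hn) hirr hroot hgen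
  have hfac : ((0 : ℤ) - (4 * a : ℤ) * θ : K) *
      aeval (θ : K) (derivative (X ^ n + C a * X ^ 2 + C b * X + C c : ℤ[X])) =
      ((b : K) - (-2 * a : ℤ) * θ) * ((n * b : ℤ) - s * θ) := by
    simp only [map_add, map_mul, map_pow, aeval_X, eq_intCast, map_intCast] at hroot
    simp only [derivative_mul, derivative_X_pow, derivative_X,
      map_add, map_mul, map_pow, aeval_X, eq_intCast, map_intCast, hs]
    have hbK : (b : K) ^ 2 = 4 * a * c := by exact_mod_cast habc
    obtain ⟨m, rfl⟩ : ∃ m, n = m + 3 := ⟨n - 3, by omega⟩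
    push_cast [show m + 3 - 1 = m + 2 by omega] at *
    simp
    linear_combination (-4 * a * (m + 3 : K)) * hroot - (m + 3 : K) * hbK
  have hN := congrArg (fun x ↦ |Algebra.norm ℚ x|) hfac
  simp only [map_mul, abs_mul] at hN
  rw [← hD, h₁, h₂, h₃] at hN
  have hb : (b : ℚ) ^ n + a * b ^ 2 * (-2 * a : ℤ) ^ (n - 2) + b * b * (-2 * a : ℤ) ^ (n - 1) +
      c * (-2 * a : ℤ) ^ n = b ^ n := by
    have hbQ : (b : ℚ) ^ 2 = 4 * a * c := by exact_mod_cast habc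
    obtain ⟨m, rfl⟩ : ∃ m, n = m + 3 := ⟨n - 3, by omega⟩
    push_cast [show m + 3 - 2 = m + 1 by omega, show m + 3 - 1 = m + 2 by omega]
    linear_combination (-(a : ℚ) * (-2 * a) ^ (m + 1)) * hbQ
  rw [hb] at hN
  apply Int.cast_injective (α := ℚ)
  push_cast [abs_mul] at hN ⊢
  rw [← hN]
  simp [show n ≠ 0 by omega, abs_mul]

/-- Modulo any prime power dividing the discriminant, a prime not dividing `b` gives rise to an
integral double root. -/
lemma exists_pow_dvd_eval {K : Type*} [Field K] [NumberField K] {θ : 𝓞 K} (hn : 3 ≤ n)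
    (habc : b ^ 2 = 4 * a * c)
    (hirr : Irreducible (X ^ n + C a * X ^ 2 + C b * X + C c : ℤ[X]))
    (hroot : aeval (θ : K) (X ^ n + C a * X ^ 2 + C b * X + C c : ℤ[X]) = 0)
    (hgen : Algebra.adjoin ℚ {(θ : K)} = ⊤) {q : ℤ} (hq : Prime q) (hqb : ¬ q ∣ b) {t : ℕ}
    (ht : t ≠ 0) (hdvd : q ^ t ∣ polyDisc (X ^ n + C a * X ^ 2 + C b * X + C c)) :
    ∃ x : ℤ, q ^ t ∣ (X ^ n + C a * X ^ 2 + C b * X + C c : ℤ[X]).eval x ∧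
      q ^ t ∣ (derivative (X ^ n + C a * X ^ 2 + C b * X + C c : ℤ[X])).eval x := by
  have h4ac : ¬ q ∣ 4 * a * c := habc ▸ fun h ↦ hqb (hq.dvd_of_dvd_pow h)
  have hqc : ¬ q ∣ c := fun h ↦ h4ac (h.mul_left _)
  have hq4a : ¬ q ∣ 4 * a := fun h ↦ h4ac (h.mul_right _)
  have hqa : ¬ q ∣ a := fun h ↦ hq4a (h.mul_left _)
  have hq2 : ¬ q ∣ 2 := fun h ↦ h4ac (by
    rw [mul_assoc]; exact (h.trans (by norm_num)).mul_right _)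
  have ha : a ≠ 0 := fun h ↦ hqa (h ▸ dvd_zero q)
  obtain ⟨s, hs⟩ : ∃ s : ℤ, s = 2 * a * (2 - n) := ⟨_, rfl⟩
  set u : ℤ := (n * b) ^ n + a * (n * b) ^ 2 * s ^ (n - 2) + b * (n * b) * s ^ (n - 1) +
    c * s ^ n with hu
  have hut : q ^ t ∣ u := by
    have h := abs_polyDisc_mul_eq hn habc ha hirr hroot hgen s hs
    have h' := (dvd_abs _ _).2 (hdvd.mul_left (c * (4 * a) ^ n))
    rw [h, dvd_abs] at h'
    exact hq.pow_dvd_of_dvd_mul_left t (fun h ↦ hqb (hq.dvd_of_dvd_pow h)) h'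
  have hqs : ¬ q ∣ s := by
    intro h
    have h2n : q ∣ 2 - n :=
      (hq.dvd_or_dvd (hs ▸ h)).resolve_left fun h ↦ (hq.dvd_or_dvd h).elim hq2 hqa
    have hqu : q ∣ u := (dvd_pow_self q ht).trans hut
    have hrest : q ∣ a * (n * b) ^ 2 * s ^ (n - 2) + b * (n * b) * s ^ (n - 1) + c * s ^ n :=
      dvd_add (dvd_add ((dvd_pow h (by omega)).mul_left _) ((dvd_pow h (by omega)).mul_left _))
        ((dvd_pow h (by omega)).mul_left _)
    have hnb : q ∣ (n * b) ^ n := by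
      have := dvd_sub hqu hrest
      rwa [hu, add_assoc, add_assoc, ← add_assoc (a * _ * _), add_sub_cancel_right] at this
    have hqn := (hq.dvd_or_dvd (hq.dvd_of_dvd_pow hnb)).resolve_right hqb
    exact hq2 (by simpa using dvd_add h2n hqn)
  have hcop (z : ℤ) (hz : ¬ q ∣ z) : IsCoprime (q ^ t) z :=
    IsCoprime.pow_left (hq.irreducible.coprime_iff_not_dvd.2 hz)
  obtain ⟨α, β, hαβ⟩ := hcop s hqs
  obtain ⟨x, hx⟩ : ∃ x, q ^ t ∣ s * x - n * b :=
    ⟨β * (n * b), -α * (n * b), by linear_combination (n * b) * hαβ⟩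
  have hf0 : q ^ t ∣ x ^ n + a * x ^ 2 + b * x + c := by
    refine (hcop (s ^ n) fun h ↦ hqs (hq.dvd_of_dvd_pow h)).dvd_of_dvd_mul_left ?_
    have hmod : (s * x) ≡ n * b [ZMOD q ^ t] := (Int.modEq_iff_dvd.2 hx).symm
    have hcong : s ^ n * (x ^ n + a * x ^ 2 + b * x + c) ≡ u [ZMOD q ^ t] := by
      have e : s ^ n * (x ^ n + a * x ^ 2 + b * x + c) =
          (s * x) ^ n + a * (s * x) ^ 2 * s ^ (n - 2) + b * (s * x) * s ^ (n - 1) + c * s ^ n := by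
        obtain ⟨m, rfl⟩ : ∃ m, n = m + 3 := ⟨n - 3, by omega⟩
        simp only [show m + 3 - 2 = m + 1 by omega, show m + 3 - 1 = m + 2 by omega]
        ring
      rw [e, hu]
      gcongr
    exact hcong.dvd_iff.2 hut
  have hqx : ¬ q ∣ x := fun h ↦ hqc <| by
    have h' := (dvd_pow_self q ht).trans hf0
    refine (dvd_add_right ?_).1 h'
    exact dvd_add (dvd_add (dvd_pow h (by omega)) ((dvd_pow h (by omega)).mul_left _))
      (h.mul_left _)
  refine ⟨x, by simpa using hf0, ?_⟩
  refine (hcop x hqx).dvd_of_dvd_mul_left ((hcop _ hq4a).dvd_of_dvd_mul_left ?_)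
  have key : 4 * a * (x * (derivative (X ^ n + C a * X ^ 2 + C b * X + C c : ℤ[X])).eval x) =
      4 * a * n * (x ^ n + a * x ^ 2 + b * x + c) + (2 * a * x + b) * (s * x - n * b) := by
    simp only [derivative_add, derivative_mul, derivative_X_pow, derivative_X, derivative_C,
      eval_add, eval_mul, eval_pow, eval_X, eval_C, eval_zero, eval_one, hs]
    obtain ⟨m, rfl⟩ : ∃ m, n = m + 3 := ⟨n - 3, by omega⟩
    push_cast [show m + 3 - 1 = m + 2 by omega]
    simp
    linear_combination (m + 3 : ℤ) * habc
  rw [key]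
  exact dvd_add (hf0.mul_left _) (hx.mul_left _)

end SquareTail

/-- Removing from `N² d = P ∏ qⱼ ^ tⱼ` the largest possible square. -/
lemma eq_mul_prod_of_sq_mul_eq {ι : Type*} [Fintype ι] {N d P : ℕ} {q t : ι → ℕ}
    (hq : ∀ j, (q j).Prime) (hinj : Function.Injective q)
    (hcop : N.Coprime P) (hN : ∀ j, q j ^ (t j / 2) ∣ N)
    (h : N ^ 2 * d = P * ∏ j, q j ^ t j) :
    d = P * ∏ j, if Odd (t j) then q j else 1 := by
  have hpair : Pairwise fun i j ↦ (q i).Coprime (q j) := fun i j hij ↦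
    (Nat.coprime_primes (hq i) (hq j)).2 (hinj.ne hij)
  obtain ⟨e, rfl⟩ : ∏ j, q j ^ (t j / 2) ∣ N :=
    Fintype.prod_dvd_of_isRelPrime
      (fun i j hij ↦ Nat.coprime_iff_isRelPrime.1 ((hpair hij).pow _ _)) hN
  set M := ∏ j, q j ^ (t j / 2) with hM
  set Q := ∏ j, if Odd (t j) then q j else 1 with hQ
  have hM0 : M ≠ 0 := Finset.prod_ne_zero_iff.2 fun j _ ↦ pow_ne_zero _ (hq j).ne_zero
  have hfac : ∏ j, q j ^ t j = M ^ 2 * Q := by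
    rw [hM, hQ, ← Finset.prod_pow, ← Finset.prod_mul_distrib]
    refine Finset.prod_congr rfl fun j _ ↦ ?_
    rw [← pow_mul]
    split_ifs with hodd
    · rw [← pow_succ]
      congr 1
      have := Nat.odd_iff.1 hodd
      omega
    · rw [mul_one]
      congr 1
      have := Nat.not_odd_iff.1 hodd
      omega
  have hsq : Squarefree Q := by
    refine Finset.squarefree_prod_of_pairwise_isCoprime (fun i _ j _ hij ↦ ?_) fun j _ ↦ ?_
    · refine Nat.coprime_iff_isRelPrime.1 ?_
      dsimp only
      split_ifs <;> first | exact hpair hij | simp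
    · split_ifs
      exacts [(hq j).prime.squarefree, squarefree_one]
  have hed : e ^ 2 * d = P * Q := by
    refine Nat.eq_of_mul_eq_mul_left (pow_pos (Nat.pos_of_ne_zero hM0) 2) ?_
    rw [hfac] at h
    linarith
  have he : e ^ 2 ∣ Q :=
    (hcop.coprime_mul_left.pow_left 2).dvd_of_dvd_mul_left ⟨d, hed.symm⟩
  have he1 : e = 1 := Nat.isUnit_iff.1 (hsq e (sq e ▸ he))
  simpa [he1] using hed

theorem stmt_8 (n : ℕ) (hn : 3 ≤ n) (a b c : ℤ) (habc : b ^ 2 = 4 * a * c)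
    (f : Polynomial ℤ) (hf : f = X ^ n + C a * X ^ 2 + C b * X + C c)
    (hirr : Irreducible f)
    (K : Type*) [Field K] [NumberField K] (θ : 𝓞 K)
    (hroot : Polynomial.aeval (θ : K) f = 0)
    (hgen : Algebra.adjoin ℚ {(θ : K)} = ⊤)
    (k l : ℕ) (p : Fin k → ℕ) (q : Fin l → ℕ) (r : Fin k → ℕ) (t : Fin l → ℕ)
    (hpprime : ∀ i, (p i).Prime) (hqprime : ∀ j, (q j).Prime)
    (hpinj : Function.Injective p) (hqinj : Function.Injective q)
    (hpq : ∀ i j, p i ≠ q j)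
    (hr : ∀ i, 1 ≤ r i) (ht : ∀ j, 1 ≤ t j)
    (hpb : ∀ i, (p i : ℤ) ∣ b) (hqb : ∀ j, ¬ (q j : ℤ) ∣ b)
    (hfact : (polyDisc f).natAbs = (∏ i, p i ^ r i) * ∏ j, q j ^ t j)
    (hidx : ∀ i, ¬ (p i ∣ polyIndex θ)) :
    (NumberField.discr K).natAbs =
      (∏ i, p i ^ r i) * ∏ j, (if Odd (t j) then q j else 1) := by
  subst hf
  have hmon := monic_trinomial (a := a) (b := b) (c := c) hn
  have hsq := polyDisc_eq_sq_index_mul_discr hmon hirr hroot hgen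
  refine eq_mul_prod_of_sq_mul_eq (N := polyIndex θ) hqprime hqinj ?_ (fun j ↦ ?_) ?_
  · exact Nat.Coprime.prod_right fun i _ ↦
      (((hpprime i).coprime_iff_not_dvd.2 (hidx i)).symm.pow_right _)
  · have hdvd : ((q j : ℤ)) ^ t j ∣ polyDisc (X ^ n + C a * X ^ 2 + C b * X + C c) := by
      rw [← Int.natCast_pow, Int.natCast_dvd, hfact]
      exact (Finset.dvd_prod_of_mem (fun j ↦ q j ^ t j) (Finset.mem_univ j)).mul_left _
    obtain ⟨x, h₀, h₁⟩ := exists_pow_dvd_eval hn habc hirr hroot hgen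
      (Nat.prime_iff_prime_int.1 (hqprime j)) (hqb j) (Nat.one_le_iff_ne_zero.1 (ht j)) hdvd
    refine dvd_polyIndex hmon hirr hroot (by rw [natDegree_trinomial hn]; omega)
      (pow_ne_zero _ (hqprime j).ne_zero) x ?_ ?_
    · push_cast
      rw [← pow_mul]
      exact (pow_dvd_pow _ (Nat.div_mul_le_self _ _)).trans h₀
    · push_cast
      exact (pow_dvd_pow _ (Nat.div_le_self _ _)).trans h₁
  · rw [← hfact, hsq, Int.natAbs_mul, Int.natAbs_pow, Int.natAbs_natCast]
end
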